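/- Let Δ be a simplicial tree on finite vertex set V = {x_1,…,x_n} over a field k, and let I_Δ ⊆ k[x_1,…,x_n] be its Stanley–Reisner ideal. Then the graded Betti numbers of I_Δ satisfy: β_{i,j}(I_Δ) = 0 unless j = i + 2, and β_{i,i+2}(I_Δ) = Σ over subsets A ⊆ V with |A| = i+2 of (c(Δ_A) − 1), where c(Δ_A) is the number of connected components of the induced subcomplex Δ_A. In particular I_Δ has a 2-linear resolution. -/

import Mathlib

/-- The dimension of the kernel of `g` modulo the image of `f`. -/
noncomputable def quotDim (k : Type*) [Field k] {M N P : Type*}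
    [AddCommGroup M] [Module k M] [AddCommGroup N] [Module k N]
    [AddCommGroup P] [Module k P] (f : M →ₗ[k] N) (g : N →ₗ[k] P) : ℕ :=
  Module.finrank k ((LinearMap.ker g) ⧸
    Submodule.comap (LinearMap.ker g).subtype (LinearMap.range f))

/-- The dimension of the cokernel of `f`. -/
noncomputable def cokerDim (k : Type*) [Field k] {M N : Type*}
    [AddCommGroup M] [Module k M] [AddCommGroup N] [Module k N]
    (f : M →ₗ[k] N) : ℕ :=
  Module.finrank k (N ⧸ LinearMap.range f)

/-- An abstract simplicial complex on vertex type `V`: a collection of finite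
subsets of `V` closed under taking subsets. -/
structure SComplex (V : Type*) where
  faces : Set (Finset V)
  down_closed : ∀ {F G : Finset V}, F ∈ faces → G ⊆ F → G ∈ faces

namespace SComplex

variable {V : Type*}

/-- The facets (maximal faces) of a simplicial complex. -/
def facets (Δ : SComplex V) : Set (Finset V) :=
  {F | F ∈ Δ.faces ∧ ∀ G ∈ Δ.faces, F ⊆ G → F = G}

/-- `G` is a joint of `F` in `Δ`: `G` is a facet different from `F` with
`F ∩ H ⊆ G` for all facets `H ≠ F`. -/
def IsJoint [DecidableEq V] (Δ : SComplex V) (F G : Finset V) : Prop :=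
  G ∈ Δ.facets ∧ G ≠ F ∧ ∀ H ∈ Δ.facets, H ≠ F → F ∩ H ⊆ G

/-- A facet `F` is a leaf if it is the only facet, or it has a joint. -/
def IsLeaf [DecidableEq V] (Δ : SComplex V) (F : Finset V) : Prop :=
  F ∈ Δ.facets ∧ ((∀ H ∈ Δ.facets, H = F) ∨ ∃ G, Δ.IsJoint F G)

/-- The simplicial complex generated by a collection of finite sets. -/
def generated (S : Set (Finset V)) : SComplex V where
  faces := {F | ∃ G ∈ S, F ⊆ G}
  down_closed := fun hF h => by
    obtain ⟨G, hG, hFG⟩ := hF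
    exact ⟨G, hG, h.trans hFG⟩

/-- A forest: every nonempty subcollection (complex generated by a subset of
the facets) has a leaf. -/
def Forest [DecidableEq V] (Δ : SComplex V) : Prop :=
  ∀ S ⊆ Δ.facets, S.Nonempty → ∃ F, (generated S).IsLeaf F

/-- The link of a (finite) set `F` in `Δ`. -/
def link [DecidableEq V] (Δ : SComplex V) (F : Finset V) : SComplex V where
  faces := {G | F ∩ G = ∅ ∧ F ∪ G ∈ Δ.faces}
  down_closed := fun {G G'} hG h => by
    obtain ⟨h1, h2⟩ := hG
    constructor
    · apply Finset.subset_empty.mp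
      calc F ∩ G' ⊆ F ∩ G := Finset.inter_subset_inter (Finset.Subset.refl F) h
        _ = ∅ := h1
    · exact Δ.down_closed h2 (Finset.union_subset_union_right h)

/-- The induced subcomplex on a set `A` of vertices. -/
def induced (Δ : SComplex V) (A : Set V) : SComplex V where
  faces := {F | F ∈ Δ.faces ∧ ↑F ⊆ A}
  down_closed := fun hF h =>
    ⟨Δ.down_closed hF.1 h, fun x hx => hF.2 (Finset.coe_subset.mpr h hx)⟩

/-- Reachability between facets via chains of facets with consecutive
nonempty intersections. -/
def reach [DecidableEq V] (Δ : SComplex V) : Finset V → Finset V → Prop :=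
  Relation.ReflTransGen (fun H K => H ∈ Δ.facets ∧ K ∈ Δ.facets ∧ (H ∩ K).Nonempty)

/-- A simplicial complex is connected if any two facets are joined by a chain
of facets with pairwise consecutive nonempty intersections. -/
def Connected [DecidableEq V] (Δ : SComplex V) : Prop :=
  ∀ F ∈ Δ.facets, ∀ G ∈ Δ.facets, Δ.reach F G

/-- A tree: a connected forest. -/
def Tree [DecidableEq V] (Δ : SComplex V) : Prop := Δ.Connected ∧ Δ.Forest

/-- The number of connected components: the number of classes of facets under
the equivalence generated by having nonempty intersection. -/
noncomputable def numComponents [DecidableEq V] (Δ : SComplex V) : ℕ :=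
  Nat.card (Quot (fun F G : Δ.facets => (F.1 ∩ G.1).Nonempty))

/-- The connected component of a facet `F`: the subcollection generated by all
facets reachable from `F`. -/
def component [DecidableEq V] (Δ : SComplex V) (F : Finset V) : SComplex V :=
  generated {G | G ∈ Δ.facets ∧ Δ.reach F G}

/-- The faces of `Δ` of cardinality `n`. -/
def Face (Δ : SComplex V) (n : ℕ) : Type _ := {F : Finset V // F ∈ Δ.faces ∧ F.card = n}

/-- Simplicial chains with coefficients in `k`, in "chain degree" `n`:
formal `k`-linear combinations of faces of cardinality `n` (dimension `n-1`). -/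
abbrev Chains (k : Type*) [Field k] (Δ : SComplex V) (n : ℕ) := Δ.Face n →₀ k

/-- The simplicial boundary map from chain degree `n+1` to chain degree `n`,
given by the alternating sum of vertex deletions (vertices ordered by the
linear order on `V`). -/
noncomputable def boundary [LinearOrder V] (k : Type*) [Field k] (Δ : SComplex V) (n : ℕ) :
    Δ.Chains k (n + 1) →ₗ[k] Δ.Chains k n :=
  Finsupp.lsum k fun F =>
    ∑ v ∈ F.1.attach,
      ((-1 : k) ^ (F.1.filter (· < v.1)).card) •
        Finsupp.lsingle (⟨F.1.erase v.1,
          Δ.down_closed F.2.1 (Finset.erase_subset _ _), by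
            have h := F.2.2
            rw [Finset.card_erase_of_mem v.2, h]
            omega⟩ : Δ.Face n)

/-- The dimension (over `k`) of the reduced simplicial homology in chain degree
`c`; that is, `redHomDim k Δ c = dim_k H̃_{c-1}(Δ; k)`. -/
noncomputable def redHomDim [LinearOrder V] (k : Type*) [Field k] (Δ : SComplex V) : ℕ → ℕ
  | 0 => cokerDim k (Δ.boundary k 0)
  | (c + 1) => quotDim k (Δ.boundary k (c + 1)) (Δ.boundary k c)

/-- Reduced homology dimension indexed by an integer `d`:
`redHomDimZ k Δ d = dim_k H̃_d(Δ; k)`, which is `0` for `d < -1`. -/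
noncomputable def redHomDimZ [LinearOrder V] (k : Type*) [Field k] (Δ : SComplex V) (d : ℤ) : ℕ :=
  if d < -1 then 0 else Δ.redHomDim k (d + 1).toNat

end SComplex

lemma quotDim_add (k : Type*) [Field k] {M N P : Type*}
    [AddCommGroup M] [Module k M] [AddCommGroup N] [Module k N]
    [AddCommGroup P] [Module k P] [Module.Finite k N] (f : M →ₗ[k] N) (g : N →ₗ[k] P)
    (h : LinearMap.range f ≤ LinearMap.ker g) :
    quotDim k f g + Module.finrank k (LinearMap.range f) =
      Module.finrank k (LinearMap.ker g) := by
  unfold quotDim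
  rw [← (Submodule.comapSubtypeEquivOfLe h).finrank_eq]
  exact Submodule.finrank_quotient_add_finrank _

namespace SComplex

section Ambient

variable {V : Type*} [LinearOrder V] (k : Type*) [Field k]

/-- The incidence sign. -/
noncomputable def sg (v : V) (F : Finset V) : k := (-1 : k) ^ (F.filter (· < v)).card

/-- The ambient boundary map on all finite sets. -/
noncomputable def bd : (Finset V →₀ k) →ₗ[k] (Finset V →₀ k) :=
  Finsupp.lsum k fun F => ∑ v ∈ F, sg k v F • Finsupp.lsingle (F.erase v)

/-- The ambient cone operator. -/
noncomputable def cone (u : V) : (Finset V →₀ k) →ₗ[k] (Finset V →₀ k) :=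
  Finsupp.lsum k fun F => if u ∈ F then 0 else sg k u F • Finsupp.lsingle (insert u F)

lemma bd_single (F : Finset V) (c : k) :
    bd k (Finsupp.single F c) = ∑ v ∈ F, sg k v F • Finsupp.single (F.erase v) c := by
  simp [bd, LinearMap.sum_apply]

lemma cone_single (u : V) (F : Finset V) (c : k) :
    cone k u (Finsupp.single F c) =
      if u ∈ F then 0 else sg k u F • Finsupp.single (insert u F) c := by
  simp only [cone, Finsupp.lsum_single]
  split_ifs <;> simp

lemma sg_mul_self (v : V) (F : Finset V) : sg k v F * sg k v F = 1 := by
  unfold sg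
  rw [← mul_pow]; simp

lemma sg_insert_self (v : V) (F : Finset V) : sg k v (insert v F) = sg k v F := by
  unfold sg
  rw [Finset.filter_insert]; simp

lemma sg_insert_lt {u v : V} {F : Finset V} (hu : u ∉ F) (h : u < v) :
    sg k v (insert u F) = - sg k v F := by
  unfold sg
  rw [Finset.filter_insert, if_pos h, Finset.card_insert_of_notMem (by simp [hu]), pow_succ]
  ring

lemma sg_insert_not_lt {u v : V} {F : Finset V} (h : ¬ u < v) :
    sg k v (insert u F) = sg k v F := by
  unfold sg
  rw [Finset.filter_insert, if_neg h]

lemma sg_comm {u v : V} {F : Finset V} (hu : u ∉ F) (hv : v ∈ F) :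
    sg k u F * sg k v (insert u F) = - (sg k v F * sg k u (F.erase v)) := by
  have hF : F = insert v (F.erase v) := (Finset.insert_erase hv).symm
  have hne : u ≠ v := fun h => hu (h ▸ hv)
  have hvn : v ∉ F.erase v := Finset.notMem_erase v F
  rcases lt_or_gt_of_ne hne with h | h
  · rw [sg_insert_lt k hu h]
    have : sg k u F = sg k u (F.erase v) := by
      conv_lhs => rw [hF]
      exact sg_insert_not_lt k (not_lt.mpr h.le)
    rw [this]; ring
  · rw [sg_insert_not_lt k (not_lt.mpr h.le)]
    have : sg k u F = - sg k u (F.erase v) := by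
      conv_lhs => rw [hF]
      exact sg_insert_lt k hvn h
    rw [this]; ring

lemma bd_cone_single (u : V) (F : Finset V) (c : k) :
    bd k (cone k u (Finsupp.single F c)) + cone k u (bd k (Finsupp.single F c)) =
      Finsupp.single F c := by
  rw [cone_single, bd_single, map_sum]
  by_cases hu : u ∈ F
  · rw [if_pos hu, map_zero, zero_add, Finset.sum_eq_single u]
    · rw [map_smul, cone_single, if_neg (Finset.notMem_erase u F), Finset.insert_erase hu,
        smul_smul]
      have : sg k u F = sg k u (F.erase u) := by
        conv_lhs => rw [← Finset.insert_erase hu]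
        exact sg_insert_self k u _
      rw [this, sg_mul_self, one_smul]
    · intro b hb hbu
      rw [map_smul, cone_single, if_pos (Finset.mem_erase.mpr ⟨hbu.symm, hu⟩), smul_zero]
    · intro h; exact absurd hu h
  · rw [if_neg hu, map_smul, bd_single, Finset.sum_insert hu, Finset.erase_insert hu,
      sg_insert_self, smul_add, smul_smul, sg_mul_self, one_smul, add_assoc, Finset.smul_sum,
      ← Finset.sum_add_distrib, Finset.sum_eq_zero, add_zero]
    intro v hv
    have hne : u ≠ v := fun h => hu (h ▸ hv)
    rw [map_smul, cone_single, if_neg (fun h => hu (Finset.mem_of_mem_erase h)), smul_smul,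
      smul_smul, sg_comm k hu hv, Finset.erase_insert_of_ne hne, neg_smul, neg_add_cancel]

lemma bd_cone (u : V) (x : Finset V →₀ k) :
    bd k (cone k u x) + cone k u (bd k x) = x := by
  have : (bd k ∘ₗ cone k u + cone k u ∘ₗ bd k : (Finset V →₀ k) →ₗ[k] _) = LinearMap.id := by
    apply Finsupp.lhom_ext
    intro F c
    simpa using bd_cone_single k u F c
  simpa using LinearMap.congr_fun this x

lemma bd_bd (x : Finset V →₀ k) : bd k (bd k x) = 0 := by
  have key : ∀ F : Finset V, bd k (bd k (Finsupp.single F (1 : k))) = 0 := by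
    intro F
    induction F using Finset.induction_on with
    | empty => simp [bd_single]
    | insert u F hu ih =>
      have h1 : Finsupp.single (insert u F) (1 : k) =
          sg k u F • cone k u (Finsupp.single F 1) := by
        rw [cone_single, if_neg hu, smul_smul, sg_mul_self, one_smul]
      have h2 := bd_cone k u (Finsupp.single F (1 : k))
      have h3 := bd_cone k u (bd k (Finsupp.single F (1 : k)))
      have h4 := congrArg (bd k) h2
      rw [map_add] at h4
      rw [ih, map_zero, add_zero] at h3
      rw [h3] at h4
      rw [h1, map_smul, map_smul]
      rw [add_eq_right.mp h4, smul_zero]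
  induction x using Finsupp.induction_linear with
  | zero => simp
  | add f g hf hg => rw [map_add, map_add, hf, hg, add_zero]
  | single F c =>
    have : Finsupp.single F c = c • Finsupp.single F (1 : k) := by simp
    rw [this, map_smul, map_smul, key, smul_zero]

/-- If a linear map sends basis elements indexed by `s` to chains supported in `t`, it sends
chains supported in `s` to chains supported in `t`. -/
lemma map_supported (f : (Finset V →₀ k) →ₗ[k] (Finset V →₀ k)) (s t : Set (Finset V))
    (h : ∀ F ∈ s, f (Finsupp.single F 1) ∈ Finsupp.supported k k t)
    {x : Finset V →₀ k} (hx : x ∈ Finsupp.supported k k s) :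
    f x ∈ Finsupp.supported k k t := by
  rw [Finsupp.supported_eq_span_single] at hx
  have : Submodule.span k ((fun i => Finsupp.single i (1 : k)) '' s) ≤
      (Finsupp.supported k k t).comap f := by
    rw [Submodule.span_le]
    rintro _ ⟨F, hF, rfl⟩
    exact h F hF
  exact this hx

lemma bd_supported (s t : Set (Finset V)) (h : ∀ F ∈ s, ∀ v ∈ F, F.erase v ∈ t)
    {x : Finset V →₀ k} (hx : x ∈ Finsupp.supported k k s) :
    bd k x ∈ Finsupp.supported k k t := by
  refine map_supported k _ s t (fun F hF => ?_) hx
  rw [bd_single]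
  refine Submodule.sum_mem _ fun v hv => Submodule.smul_mem _ _ ?_
  exact Finsupp.single_mem_supported k _ (h F hF v hv)

lemma cone_supported (u : V) (s t : Set (Finset V)) (h : ∀ F ∈ s, u ∉ F → insert u F ∈ t)
    {x : Finset V →₀ k} (hx : x ∈ Finsupp.supported k k s) :
    cone k u x ∈ Finsupp.supported k k t := by
  refine map_supported k _ s t (fun F hF => ?_) hx
  rw [cone_single]
  split_ifs with hu
  · exact Submodule.zero_mem _
  · exact Submodule.smul_mem _ _ (Finsupp.single_mem_supported k _ (h F hF hu))

/-- Faces of `Δ` inside `A` of cardinality `n`. -/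
def fs (Δ : SComplex V) (A : Finset V) (n : ℕ) : Set (Finset V) :=
  {F | F ∈ Δ.faces ∧ F ⊆ A ∧ F.card = n}

lemma acyclic (Δ : SComplex V)
    (free : ∀ A : Finset V, A.Nonempty → ∃ v ∈ A, ∃ F ∈ Δ.faces, F ⊆ A ∧
      ∀ H ∈ Δ.faces, H ⊆ A → v ∈ H → H ⊆ F) (n : ℕ) (hn : 1 ≤ n) (A : Finset V) :
    ∀ z ∈ Finsupp.supported k k (fs Δ A (n + 1)), bd k z = 0 →
      ∃ w ∈ Finsupp.supported k k (fs Δ A (n + 2)), bd k w = z := by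
  induction A using Finset.strongInduction with
  | H A ih =>
  intro z hz hbz
  rcases A.eq_empty_or_nonempty with rfl | hA
  · refine ⟨0, Submodule.zero_mem _, ?_⟩
    have : fs Δ ∅ (n + 1) = ∅ := by
      ext F
      simp only [fs, Set.mem_setOf_eq, Set.mem_empty_iff_false, iff_false]
      rintro ⟨-, h1, h2⟩
      rw [Finset.subset_empty.mp h1] at h2
      simp at h2
    rw [this] at hz
    simp at hz
    simp [hz]
  obtain ⟨v, hvA, F, hF, hFA, hfree⟩ := free A hA
  have hss : A.erase v ⊂ A := Finset.erase_ssubset hvA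
  have mono : ∀ m, fs Δ (A.erase v) m ⊆ fs Δ A m := fun m H hH =>
    ⟨hH.1, hH.2.1.trans (Finset.erase_subset _ _), hH.2.2⟩
  by_cases hu : ∃ u ∈ F, u ≠ v
  · obtain ⟨u, huF, huv⟩ := hu
    set zv := z.filter (fun H => v ∈ H) with hzv
    set zr := z.filter (fun H => ¬ v ∈ H) with hzr
    have hsum : zv + zr = z := Finsupp.filter_pos_add_filter_neg z _
    have hz' := (Finsupp.mem_supported k z).mp hz
    have szv : zv ∈ Finsupp.supported k k {H | H ∈ fs Δ A (n + 1) ∧ v ∈ H} := by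
      rw [Finsupp.mem_supported]
      intro H hH
      rw [hzv, Finsupp.support_filter, Finset.coe_filter] at hH
      exact ⟨hz' hH.1, hH.2⟩
    have szr : zr ∈ Finsupp.supported k k {H | H ∈ fs Δ A (n + 1) ∧ v ∉ H} := by
      rw [Finsupp.mem_supported]
      intro H hH
      rw [hzr, Finsupp.support_filter, Finset.coe_filter] at hH
      exact ⟨hz' hH.1, hH.2⟩
    have hw : cone k u zv ∈ Finsupp.supported k k (fs Δ A (n + 2)) := by
      refine cone_supported k u _ _ ?_ szv
      rintro H ⟨⟨h1, h2, h3⟩, h4⟩ h5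
      have hs : insert u H ⊆ F := Finset.insert_subset huF (hfree H h1 h2 h4)
      exact ⟨Δ.down_closed hF hs, hs.trans hFA, by rw [Finset.card_insert_of_notMem h5, h3]⟩
    have hb1 : bd k zv ∈ Finsupp.supported k k {H | H ⊆ F ∧ H.card = n} := by
      refine bd_supported k _ _ ?_ szv
      rintro H ⟨⟨h1, h2, h3⟩, h4⟩ w hw
      exact ⟨(Finset.erase_subset _ _).trans (hfree H h1 h2 h4), by
        rw [Finset.card_erase_of_mem hw, h3]; rfl⟩
    have hb2 : bd k zv ∈ Finsupp.supported k k {H : Finset V | v ∉ H} := by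
      have : bd k zv = - bd k zr := by
        rw [eq_neg_iff_add_eq_zero, ← map_add, hsum, hbz]
      rw [this]
      refine Submodule.neg_mem _ (bd_supported k _ _ ?_ szr)
      rintro H ⟨-, h4⟩ w hw h5
      exact h4 (Finset.mem_of_mem_erase h5)
    have hb3 : bd k zv ∈ Finsupp.supported k k {H | (H ⊆ F ∧ H.card = n) ∧ v ∉ H} := by
      rw [Finsupp.mem_supported] at *
      exact fun H hH => ⟨hb1 hH, hb2 hH⟩
    have hc : cone k u (bd k zv) ∈ Finsupp.supported k k (fs Δ (A.erase v) (n + 1)) := by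
      refine cone_supported k u _ _ ?_ hb3
      rintro H ⟨⟨h1, h2⟩, h3⟩ h5
      have hs : insert u H ⊆ F := Finset.insert_subset huF h1
      refine ⟨Δ.down_closed hF hs, ?_, by rw [Finset.card_insert_of_notMem h5, h2]⟩
      intro x hx
      refine Finset.mem_erase.mpr ⟨?_, hFA (hs hx)⟩
      rintro rfl
      rcases Finset.mem_insert.mp hx with h | h
      · exact huv h.symm
      · exact h3 h
    have hr : zr ∈ Finsupp.supported k k (fs Δ (A.erase v) (n + 1)) := by
      refine Finsupp.supported_mono ?_ szr
      rintro H ⟨⟨h1, h2, h3⟩, h4⟩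
      exact ⟨h1, Finset.subset_erase.mpr ⟨h2, h4⟩, h3⟩
    have hcyc := bd_cone k u zv
    have hz2 : zr + cone k u (bd k zv) = z - bd k (cone k u zv) := by
      rw [← hsum]; nth_rewrite 2 [← hcyc]; abel
    obtain ⟨w, hw1, hw2⟩ := ih _ hss (zr + cone k u (bd k zv)) (Submodule.add_mem _ hr hc) (by
      rw [hz2, map_sub, hbz, bd_bd, sub_zero])
    refine ⟨w + cone k u zv, Submodule.add_mem _ (Finsupp.supported_mono (mono _) hw1) hw, ?_⟩
    rw [map_add, hw2, hz2]; abel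
  · push Not at hu
    have hr : z ∈ Finsupp.supported k k (fs Δ (A.erase v) (n + 1)) := by
      refine Finsupp.supported_mono ?_ hz
      rintro H ⟨h1, h2, h3⟩
      refine ⟨h1, Finset.subset_erase.mpr ⟨h2, fun h4 => ?_⟩, h3⟩
      have h5 : H ⊆ {v} := fun x hx => by
        simpa using hu x (hfree H h1 h2 h4 hx)
      have := Finset.card_le_card h5
      simp at this
      omega
    obtain ⟨w, hw1, hw2⟩ := ih _ hss z hr hbz
    exact ⟨w, Finsupp.supported_mono (mono _) hw1, hw2⟩

/-- Embedding of chains into ambient chains. -/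
noncomputable def emb (Δ : SComplex V) (n : ℕ) : Δ.Chains k n →ₗ[k] (Finset V →₀ k) :=
  Finsupp.lmapDomain k k (fun F : Δ.Face n => F.1)

lemma emb_injective (Δ : SComplex V) (n : ℕ) : Function.Injective (emb k Δ n) :=
  Finsupp.mapDomain_injective Subtype.val_injective

lemma emb_single (Δ : SComplex V) (n : ℕ) (F : Δ.Face n) (c : k) :
    emb k Δ n (Finsupp.single F c) = Finsupp.single F.1 c := by
  simp [emb]

/-- Vertex deletion. -/
def er (Δ : SComplex V) {n : ℕ} (F : Δ.Face (n + 1)) (v : V) (hv : v ∈ F.1) : Δ.Face n :=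
  ⟨F.1.erase v, Δ.down_closed F.2.1 (Finset.erase_subset _ _), by
    rw [Finset.card_erase_of_mem hv, F.2.2]; rfl⟩

lemma boundary_single (Δ : SComplex V) (n : ℕ) (F : Δ.Face (n + 1)) (c : k) :
    Δ.boundary k n (Finsupp.single F c) = ∑ v ∈ F.1.attach,
      Finsupp.single (er Δ F v.1 v.2) (sg k v.1 F.1 * c) := by
  unfold boundary
  refine (Finsupp.lsum_single _ _ _ _).trans ?_
  refine (LinearMap.sum_apply _ _ _).trans ?_
  refine Finset.sum_congr rfl fun v _ => ?_
  refine (Finsupp.smul_single _ _ _).trans ?_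
  rfl

lemma emb_boundary (Δ : SComplex V) (n : ℕ) (x : Δ.Chains k (n + 1)) :
    emb k Δ n (Δ.boundary k n x) = bd k (emb k Δ (n + 1) x) := by
  have : (emb k Δ n ∘ₗ Δ.boundary k n) = bd k ∘ₗ emb k Δ (n + 1) := by
    apply Finsupp.lhom_ext
    intro F c
    rw [LinearMap.comp_apply, LinearMap.comp_apply, boundary_single, emb_single, bd_single]
    refine (map_sum _ _ _).trans ?_
    refine Eq.trans ?_ (Finset.sum_attach F.1 _)
    refine Finset.sum_congr rfl fun v _ => ?_
    rw [emb_single, Finsupp.smul_single]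
    rfl
  exact LinearMap.congr_fun this x

lemma boundary_boundary (Δ : SComplex V) (n : ℕ) (x : Δ.Chains k (n + 2)) :
    Δ.boundary k n (Δ.boundary k (n + 1) x) = 0 := by
  apply emb_injective
  rw [emb_boundary, emb_boundary, bd_bd, map_zero]

lemma range_emb (Δ : SComplex V) (n : ℕ) :
    LinearMap.range (emb k Δ n) =
      Finsupp.supported k k {F | F ∈ Δ.faces ∧ F.card = n} := by
  rw [emb, Finsupp.range_lmapDomain, Finsupp.supported_eq_span_single]
  congr 1
  ext x
  constructor
  · rintro ⟨F, rfl⟩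
    exact ⟨F.1, F.2, rfl⟩
  · rintro ⟨F, hF, rfl⟩
    exact ⟨⟨F, hF⟩, rfl⟩

lemma induced_set (Δ : SComplex V) (A : Finset V) (n : ℕ) :
    {F | F ∈ (Δ.induced ↑A).faces ∧ F.card = n} = fs Δ A n := by
  ext F
  simp [induced, fs, and_assoc]

lemma redHomDim_high (Δ : SComplex V)
    (free : ∀ A : Finset V, A.Nonempty → ∃ v ∈ A, ∃ F ∈ Δ.faces, F ⊆ A ∧
      ∀ H ∈ Δ.faces, H ⊆ A → v ∈ H → H ⊆ F) (n : ℕ) (hn : 1 ≤ n) (A : Finset V) :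
    (Δ.induced ↑A).redHomDim k (n + 1) = 0 := by
  simp only [redHomDim, quotDim]
  have : Submodule.comap (LinearMap.ker ((Δ.induced ↑A).boundary k n)).subtype
      (LinearMap.range ((Δ.induced ↑A).boundary k (n + 1))) = ⊤ := by
    rw [eq_top_iff]
    rintro ⟨z, hz⟩ -
    rw [LinearMap.mem_ker] at hz
    have h1 : emb k (Δ.induced ↑A) (n + 1) z ∈ Finsupp.supported k k (fs Δ A (n + 1)) := by
      rw [← induced_set, ← range_emb]; exact ⟨z, rfl⟩
    have h2 : bd k (emb k (Δ.induced ↑A) (n + 1) z) = 0 := by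
      rw [← emb_boundary, hz, map_zero]
    obtain ⟨w, hw, hwz⟩ := acyclic k Δ free n hn A _ h1 h2
    rw [← induced_set, ← range_emb] at hw
    obtain ⟨w', rfl⟩ := hw
    rw [Submodule.mem_comap]
    refine ⟨w', emb_injective k _ _ ?_⟩
    rw [emb_boundary, hwz]; rfl
  rw [this]
  exact Module.finrank_zero_of_subsingleton

lemma exists_facet [Finite V] (Δ : SComplex V) {F : Finset V} (hF : F ∈ Δ.faces) :
    ∃ G ∈ Δ.facets, F ⊆ G := by
  obtain ⟨G, hG, hmax⟩ := (Set.toFinite Δ.faces).exists_le_maximal hF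
  exact ⟨G, ⟨hmax.prop, fun H hH hGH => le_antisymm hGH (hmax.le_of_ge hH hGH)⟩, hG⟩

lemma facets_generated (Δ : SComplex V) {S : Set (Finset V)} (hS : S ⊆ Δ.facets) :
    (generated S).facets = S := by
  ext F
  constructor
  · rintro ⟨⟨G, hG, hFG⟩, hmax⟩
    rw [hmax G ⟨G, hG, le_rfl⟩ hFG]
    exact hG
  · intro hF
    refine ⟨⟨F, hF, le_rfl⟩, ?_⟩
    rintro G ⟨H, hH, hGH⟩ hFG
    have := (hS hF).2 H (hS hH).1 (hFG.trans hGH)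
    subst this
    exact le_antisymm hFG hGH

lemma free_of_forest [Finite V] (Δ : SComplex V) (hsing : ∀ v : V, {v} ∈ Δ.faces)
    (hΔ : Δ.Forest) (A : Finset V) (hA : A.Nonempty) : ∃ v ∈ A, ∃ F ∈ Δ.faces, F ⊆ A ∧
      ∀ H ∈ Δ.faces, H ⊆ A → v ∈ H → H ⊆ F := by
  let P : Set (Set (Finset V)) :=
    {S | S ⊆ Δ.facets ∧ ∀ H ∈ Δ.faces, H ⊆ A → ∃ F ∈ S, H ⊆ F}
  have hP : P.Nonempty := ⟨Δ.facets, le_rfl, fun H hH _ => exists_facet Δ hH⟩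
  obtain ⟨S, hS⟩ := (Set.toFinite P).exists_minimal hP
  obtain ⟨hS1, hS2⟩ := hS.prop
  obtain ⟨a, ha⟩ := hA
  obtain ⟨F₀, hF₀, -⟩ := hS2 {a} (hsing a) (by simpa using ha)
  obtain ⟨F, hF, hleaf⟩ := hΔ S hS1 ⟨F₀, hF₀⟩
  simp only [IsJoint] at hleaf
  rw [facets_generated Δ hS1] at hF hleaf
  have hface : F ∩ A ∈ Δ.faces := Δ.down_closed (hS1 hF).1 Finset.inter_subset_left
  rcases hleaf with h | ⟨G, hG, hGF, hj⟩
  · refine ⟨a, ha, F ∩ A, hface, Finset.inter_subset_right, fun H hH hHA _ => ?_⟩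
    obtain ⟨F', hF', hHF'⟩ := hS2 H hH hHA
    rw [h F' hF'] at hHF'
    exact Finset.subset_inter hHF' hHA
  · have hnot : ¬ (S \ {F}) ∈ P := fun h => by
      have := hS.le_of_le h Set.diff_subset hF
      exact this.2 rfl
    have : ∃ H ∈ Δ.faces, H ⊆ A ∧ ∀ F' ∈ S, F' ≠ F → ¬ H ⊆ F' := by
      by_contra hcon
      push Not at hcon
      refine hnot ⟨Set.diff_subset.trans hS1, fun H hH hHA => ?_⟩
      obtain ⟨F', h1, h2, h3⟩ := hcon H hH hHA
      exact ⟨F', ⟨h1, h2⟩, h3⟩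
    obtain ⟨H, hH, hHA, hn⟩ := this
    obtain ⟨v, hvH, hvG⟩ := Finset.not_subset.mp (hn G hG hGF)
    have only : ∀ H ∈ Δ.faces, H ⊆ A → H ⊆ F ∨ ∃ F' ∈ S, F' ≠ F ∧ H ⊆ F' := by
      intro H hH hHA
      obtain ⟨F', hF', hs⟩ := hS2 H hH hHA
      by_cases he : F' = F
      · left; rwa [he] at hs
      · right; exact ⟨F', hF', he, hs⟩
    have hHF : H ⊆ F := by
      rcases only H hH hHA with h | ⟨F', h1, h2, h3⟩
      · exact h
      · exact absurd h3 (hn F' h1 h2)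
    refine ⟨v, hHA hvH, F ∩ A, hface, Finset.inter_subset_right, fun H' hH' hHA' hv' => ?_⟩
    rcases only H' hH' hHA' with h | ⟨F', h1, h2, h3⟩
    · exact Finset.subset_inter h hHA'
    · exact absurd (hj F' h1 h2 (Finset.mem_inter.mpr ⟨hHF hvH, h3 hv'⟩)) hvG

/-- A vertex as a face of cardinality one. -/
def vtx (K : SComplex V) (v : V) (hv : {v} ∈ K.faces) : K.Face 1 :=
  ⟨{v}, hv, Finset.card_singleton v⟩

lemma exists_vtx (K : SComplex V) (F : K.Face 1) : ∃ v, ∃ hv : {v} ∈ K.faces, F = vtx K v hv := by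
  obtain ⟨F, hF, hc⟩ := F
  obtain ⟨v, rfl⟩ := Finset.card_eq_one.mp hc
  exact ⟨v, hF, rfl⟩

/-- The empty face. -/
def emptyFace (K : SComplex V) (h : ∅ ∈ K.faces) : K.Face 0 := ⟨∅, h, rfl⟩

lemma boundary_zero_vtx (K : SComplex V) (v : V) (hv : {v} ∈ K.faces) (c : k) :
    K.boundary k 0 (Finsupp.single (vtx K v hv) c) =
      Finsupp.single (emptyFace K (K.down_closed hv (Finset.empty_subset _))) c := by
  apply emb_injective
  rw [emb_boundary, emb_single, emb_single]
  change bd k (Finsupp.single {v} c) = Finsupp.single ∅ c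
  rw [bd_single, Finset.sum_singleton]
  simp [sg, Finset.filter_singleton]

lemma boundary_zero_surjective (K : SComplex V) (v : V) (hv : {v} ∈ K.faces) :
    Function.Surjective (K.boundary k 0) := by
  rw [← LinearMap.range_eq_top, eq_top_iff]
  intro x _
  induction x using Finsupp.induction_linear with
  | zero => exact Submodule.zero_mem _
  | add f g hf hg => exact Submodule.add_mem _ (hf trivial) (hg trivial)
  | single F c =>
    refine ⟨Finsupp.single (vtx K v hv) c, ?_⟩
    rw [boundary_zero_vtx]
    congr 1
    exact Subtype.ext (Finset.card_eq_zero.mp F.2.2).symm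

lemma redHomDim_zero (K : SComplex V) (v : V) (hv : {v} ∈ K.faces) :
    K.redHomDim k 0 = 0 := by
  simp only [redHomDim, cokerDim]
  rw [LinearMap.range_eq_top.mpr (boundary_zero_surjective k K v hv)]
  exact Module.finrank_zero_of_subsingleton

/-- Two vertices of a face are homologous. -/
lemma edge_mem (K : SComplex V) {F : Finset V} (hF : F ∈ K.faces) {a b : V} (ha : {a} ∈ K.faces)
    (hb : {b} ∈ K.faces) (haF : a ∈ F) (hbF : b ∈ F) (c : k) :
    Finsupp.single (vtx K a ha) c - Finsupp.single (vtx K b hb) c ∈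
      LinearMap.range (K.boundary k 1) := by
  wlog hab : a < b generalizing a b
  · rcases eq_or_lt_of_le (not_lt.mp hab) with rfl | h
    · rw [sub_self]; exact Submodule.zero_mem _
    · rw [← neg_sub]; exact Submodule.neg_mem _ (this hb ha hbF haF h)
  have hs : ({a, b} : Finset V) ∈ K.faces :=
    K.down_closed hF (Finset.insert_subset haF (Finset.singleton_subset_iff.mpr hbF))
  let e : K.Face (1 + 1) := ⟨{a, b}, hs, Finset.card_pair hab.ne⟩
  refine ⟨Finsupp.single e (-c), ?_⟩
  apply emb_injective
  rw [emb_boundary, map_sub, emb_single, emb_single, emb_single]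
  change bd k (Finsupp.single {a, b} (-c)) = Finsupp.single {a} c - Finsupp.single {b} c
  rw [bd_single, Finset.sum_pair hab.ne]
  have h1 : ({a, b} : Finset V).erase a = {b} := by
    ext x; simp only [Finset.mem_erase, Finset.mem_insert, Finset.mem_singleton]
    constructor
    · tauto
    · rintro rfl; exact ⟨hab.ne', Or.inr rfl⟩
  have h2 : ({a, b} : Finset V).erase b = {a} := by
    ext x; simp only [Finset.mem_erase, Finset.mem_insert, Finset.mem_singleton]
    constructor
    · tauto
    · rintro rfl; exact ⟨hab.ne, Or.inl rfl⟩
  have h3 : sg k a {a, b} = 1 := by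
    rw [sg_insert_self]; simp [sg, Finset.filter_singleton, not_lt.mpr hab.le, Finset.filter_false_of_mem]
  have h4 : sg k b {a, b} = -1 := by
    rw [sg_insert_lt k (by simpa using hab.ne) hab]; simp [sg, Finset.filter_singleton]
  rw [h1, h2, h3, h4]
  simp [Finsupp.single_neg]
  abel

lemma redHomDim_one [Finite V] (K : SComplex V) (v₀ : V) (hv₀ : {v₀} ∈ K.faces) :
    K.redHomDim k 1 = K.numComponents - 1 := by
  classical
  let R : K.facets → K.facets → Prop := fun F G => (F.1 ∩ G.1).Nonempty
  have hcomp : K.numComponents = Nat.card (Quot R) := rfl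
  haveI : Finite (Quot R) := Finite.of_surjective (Quot.mk R) Quot.mk_surjective
  haveI hfin1 : Finite (K.Face 1) := inferInstanceAs (Finite {F // F ∈ K.faces ∧ F.card = 1})
  haveI hfin0 : Finite (K.Face 0) := inferInstanceAs (Finite {F // F ∈ K.faces ∧ F.card = 0})
  haveI : Module.Finite k (K.Chains k 1) := inferInstanceAs (Module.Finite k (K.Face 1 →₀ k))
  haveI : Module.Finite k (K.Chains k 0) := inferInstanceAs (Module.Finite k (K.Face 0 →₀ k))
  -- facet of a vertex
  have hchoice : ∀ F : K.Face 1, ∃ G : K.facets, F.1 ⊆ G.1 := fun F => by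
    obtain ⟨G, hG, h⟩ := exists_facet K F.2.1
    exact ⟨⟨G, hG⟩, h⟩
  choose φ hφ using hchoice
  let q : K.Face 1 → Quot R := fun F => Quot.mk R (φ F)
  have hq : ∀ (v : V) (hv : {v} ∈ K.faces) (G : K.facets), v ∈ G.1 →
      q (vtx K v hv) = Quot.mk R G := fun v hv G hvG =>
    Quot.sound ⟨v, Finset.mem_inter.mpr ⟨hφ (vtx K v hv) (Finset.mem_singleton_self v), hvG⟩⟩
  -- vertex of a facet
  have hne : ∀ G : K.facets, ∃ v, v ∈ G.1 := fun G => by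
    by_contra hcon
    have he : G.1 = ∅ := Finset.eq_empty_of_forall_notMem fun v hv => hcon ⟨v, hv⟩
    have := G.2.2 _ hv₀ (by rw [he]; exact Finset.empty_subset _)
    rw [he] at this
    exact (Finset.singleton_ne_empty v₀) this.symm
  choose ψ hψ using hne
  have hvf : ∀ (G : K.facets) (v : V), v ∈ G.1 → {v} ∈ K.faces := fun G v hv =>
    K.down_closed G.2.1 (Finset.singleton_subset_iff.mpr hv)
  let π : K.Chains k 1 →ₗ[k] (Quot R →₀ k) := Finsupp.lmapDomain k k q
  have hπs : ∀ (F : K.Face 1) (c : k), π (Finsupp.single F c) = Finsupp.single (q F) c :=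
    fun F c => Finsupp.mapDomain_single
  have hπsurj : Function.Surjective π := by
    refine Finsupp.mapDomain_surjective ?_
    intro x
    induction x using Quot.ind with
    | mk G => exact ⟨vtx K (ψ G) (hvf G _ (hψ G)), hq _ _ _ (hψ G)⟩
  let B := LinearMap.range (K.boundary k 1)
  -- back map
  let τ : Quot R → (K.Chains k 1 ⧸ B) := Quot.lift
    (fun G => B.mkQ (Finsupp.single (vtx K (ψ G) (hvf G _ (hψ G))) 1)) (by
      rintro G H ⟨x, hx⟩
      rw [Finset.mem_inter] at hx
      have hxv := hvf G x hx.1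
      have e1 := edge_mem k K G.2.1 (hvf G _ (hψ G)) hxv (hψ G) hx.1 1
      have e2 := edge_mem k K H.2.1 hxv (hvf H _ (hψ H)) hx.2 (hψ H) 1
      refine (Submodule.Quotient.eq B).mpr ?_
      have := Submodule.add_mem _ e1 e2
      rwa [sub_add_sub_cancel] at this)
  let σ : (Quot R →₀ k) →ₗ[k] (K.Chains k 1 ⧸ B) := Finsupp.lsum k fun x =>
    LinearMap.toSpanSingleton k _ (τ x)
  have hσπ : σ ∘ₗ π = B.mkQ := by
    apply Finsupp.lhom_ext
    intro F c
    obtain ⟨v, hv, rfl⟩ := exists_vtx K F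
    rw [LinearMap.comp_apply, hπs]
    have h1 : σ (Finsupp.single (q (vtx K v hv)) c) = c • τ (q (vtx K v hv)) := by
      refine (Finsupp.lsum_single _ _ _ _).trans ?_
      exact LinearMap.toSpanSingleton_apply _ _ _ _
    rw [h1]
    have h2 : τ (q (vtx K v hv)) = B.mkQ (Finsupp.single (vtx K v hv) 1) := by
      refine (Submodule.Quotient.eq B).mpr ?_
      exact edge_mem k K (φ (vtx K v hv)).2.1 _ _ (hψ _)
        (hφ (vtx K v hv) (Finset.mem_singleton_self v)) 1
    rw [h2, ← map_smul]
    congr 1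
    exact (Finsupp.smul_single _ _ _).trans (by rw [smul_eq_mul, mul_one])
  have hker : LinearMap.ker π = B := by
    apply le_antisymm
    · intro x hx
      rw [LinearMap.mem_ker] at hx
      have := LinearMap.congr_fun hσπ x
      rw [LinearMap.comp_apply, hx, map_zero] at this
      exact (Submodule.Quotient.mk_eq_zero B).mp this.symm
    · rintro _ ⟨x, rfl⟩
      rw [LinearMap.mem_ker]
      have : π ∘ₗ K.boundary k 1 = 0 := by
        apply Finsupp.lhom_ext
        intro F c
        obtain ⟨G, hG, hFG⟩ := exists_facet K F.2.1
        obtain ⟨a, b, hab, hFab⟩ := Finset.card_eq_two.mp F.2.2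
        have hq' : ∀ v (hv : v ∈ F.1), q (er K F v hv) = Quot.mk R ⟨G, hG⟩ := by
          intro v hv
          obtain ⟨w, hw, hw'⟩ := exists_vtx K (er K F v hv)
          rw [hw']
          refine hq w hw ⟨G, hG⟩ (hFG ?_)
          have h5 : F.1.erase v = {w} := congrArg Subtype.val hw'
          have : w ∈ F.1.erase v := by rw [h5]; exact Finset.mem_singleton_self w
          exact Finset.mem_of_mem_erase this
        rw [LinearMap.comp_apply, boundary_single]
        refine (map_sum π _ _).trans ?_
        have h6 : ∀ v ∈ F.1.attach, π (Finsupp.single (er K F v.1 v.2) (sg k v.1 F.1 * c)) =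
            Finsupp.single (Quot.mk R ⟨G, hG⟩) (sg k v.1 F.1 * c) := fun v _ => by
          rw [hπs, hq']
        rw [Finset.sum_congr rfl h6]
        rw [Finset.sum_attach F.1 (fun v => Finsupp.single (Quot.mk R ⟨G, hG⟩) (sg k v F.1 * c))]
        have hsg : ∑ v ∈ F.1, sg k v F.1 = 0 := by
          rw [hFab]
          clear hq' h6 hFG hG
          clear hFab
          wlog hlt : a < b generalizing a b
          · have := this b a hab.symm (lt_of_le_of_ne (not_lt.mp hlt) hab.symm)
            rwa [Finset.pair_comm]
          rw [Finset.sum_pair hab, sg_insert_self, sg_insert_lt k (by simpa using hab) hlt]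
          have h7 : ¬ b < a := not_lt.mpr hlt.le
          simp [sg, Finset.filter_singleton, h7]
        rw [← Finsupp.single_finsetSum, ← Finset.sum_mul, hsg, zero_mul, Finsupp.single_zero]
        rfl
      exact LinearMap.congr_fun this x
  let Z : Submodule k (K.Chains k 1) := LinearMap.ker (K.boundary k 0)
  have hsub : B ≤ Z := by
    rintro _ ⟨x, rfl⟩
    exact boundary_boundary k K 0 x
  have d1 := LinearMap.finrank_range_add_finrank_ker π
  rw [LinearMap.range_eq_top.mpr hπsurj, finrank_top, hker] at d1
  have d2 := LinearMap.finrank_range_add_finrank_ker (K.boundary k 0)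
  rw [LinearMap.range_eq_top.mpr (boundary_zero_surjective k K v₀ hv₀), finrank_top] at d2
  have d3 : Module.finrank k (K.Chains k 0) = 1 := by
    haveI : Unique (K.Face 0) :=
      { default := emptyFace K (K.down_closed hv₀ (Finset.empty_subset _))
        uniq := fun F => Subtype.ext (Finset.card_eq_zero.mp F.2.2) }
    exact (Module.finrank_finsupp_self k).trans (Fintype.card_unique)
  have d4 : Module.finrank k (Quot R →₀ k) = Nat.card (Quot R) := by
    haveI := Fintype.ofFinite (Quot R)
    rw [Module.finrank_finsupp_self, Nat.card_eq_fintype_card]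
  have d5 : K.redHomDim k 1 + Module.finrank k B = Module.finrank k Z :=
    quotDim_add k (K.boundary k 1) (K.boundary k 0) hsub
  have d6 : Module.finrank k Z = Module.finrank k (LinearMap.ker (K.boundary k 0)) := rfl
  have d7 : Module.finrank k (K.Chains k (0 + 1)) = Module.finrank k (K.Chains k 1) := rfl
  rw [hcomp]
  omega

end Ambient

end SComplex

/-- For a simplicial tree `Δ`, the graded Betti numbers of the
Stanley-Reisner ideal `I_Δ` (given by Hochster's formula
`β i j = Σ_(A ⊆ V, |A| = j) dim_k H̃_(j-i-2)((Δ_A); k)`, which may be assumed)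
vanish unless `j = i + 2`, and `β i (i+2)` is the sum over `A` with `|A| = i + 2`
of (number of connected components of `Δ_A` minus 1). In particular `I_Δ` has a
2-linear resolution. -/
theorem betti_numbers_of_tree {V : Type*} [LinearOrder V] [Fintype V]
    (k : Type*) [Field k] (Δ : SComplex V) (hsing : ∀ v : V, {v} ∈ Δ.faces)
    (hΔ : Δ.Tree) (β : ℕ → ℕ → ℕ)
    (hochster : ∀ i j, β i j =
      ∑ A ∈ Finset.powersetCard j (Finset.univ : Finset V),
        (Δ.induced ↑A).redHomDimZ k ((j : ℤ) - i - 2)) :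
    (∀ i j, j ≠ i + 2 → β i j = 0) ∧
    (∀ i, β i (i + 2) =
      ∑ A ∈ Finset.powersetCard (i + 2) (Finset.univ : Finset V),
        ((Δ.induced ↑A).numComponents - 1)) := by 
  classical
  have free := SComplex.free_of_forest Δ hsing hΔ.2
  have hv : ∀ (A : Finset V) (v : V), v ∈ A → {v} ∈ (Δ.induced ↑A).faces := fun A v h =>
    ⟨hsing v, by simpa using h⟩
  refine ⟨fun i j hij => ?_, fun i => ?_⟩
  · rw [hochster]
    refine Finset.sum_eq_zero fun A hA => ?_
    have hc := (Finset.mem_powersetCard.mp hA).2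
    unfold SComplex.redHomDimZ
    split_ifs with hlt
    · rfl
    · rcases Nat.lt_or_ge j (i + 2) with h | h
      · have h0 : ((j : ℤ) - i - 2 + 1).toNat = 0 := by omega
        rw [h0]
        obtain ⟨v, hvA⟩ : A.Nonempty := Finset.card_pos.mp (by omega)
        exact SComplex.redHomDim_zero k _ v (hv A v hvA)
      · obtain ⟨n, hn⟩ : ∃ n, j = i + 2 + n := ⟨j - (i + 2), by omega⟩
        have h0 : ((j : ℤ) - i - 2 + 1).toNat = n + 1 := by omega
        rw [h0]
        exact SComplex.redHomDim_high k Δ free n (by omega) A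
  · rw [hochster]
    refine Finset.sum_congr rfl fun A hA => ?_
    have hc := (Finset.mem_powersetCard.mp hA).2
    unfold SComplex.redHomDimZ
    have h0 : (((i + 2 : ℕ) : ℤ) - i - 2 + 1).toNat = 1 := by omega
    rw [if_neg (by omega), h0]
    obtain ⟨v, hvA⟩ : A.Nonempty := Finset.card_pos.mp (by omega)
    exact SComplex.redHomDim_one k _ v (hv A v hvA)
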